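/- arXiv:1509.08349 — 2 statements merged into one kernel-verified Lean document; each statement's English description precedes it below -/
import Mathlib

section
/- With B(x) := b̄ (e₃ + ∂₃η(x)) and A(x) := ((I + ∇η(x))⁻¹)ᵀ, one has, for each i ∈ {1,2,3} and every x ∈ U, ∑_{j,k} B_j(x) A_{jk}(x) ∂_k B_i(x) = b̄² ∂₃² η_i(x); that is, the Lorentz force term B·∇_A B equals b̄² ∂₃² η. -/
open Matrix

/-- The Jacobian matrix `Dη(x)` of `η : ℝ³ → ℝ³`, entries `(Dη)_{ij} = ∂η_i/∂x_j`. -/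
noncomputable def jacS (η : (Fin 3 → ℝ) → Fin 3 → ℝ) (x : Fin 3 → ℝ) :
    Matrix (Fin 3) (Fin 3) ℝ :=
  Matrix.of fun i j => fderiv ℝ (fun y => η y i) x (Pi.single j 1)

/-- with `B(x) = b̄ (e₃ + ∂₃η(x))` and `A = ((I + ∇η)⁻¹)ᵀ`, the
Lorentz force term satisfies `B·∇_A B = b̄² ∂₃²η` on `U`. -/
theorem lorentz_force_formula (U : Set (Fin 3 → ℝ)) (hU : IsOpen U)
    (η : (Fin 3 → ℝ) → Fin 3 → ℝ) (hη : ContDiffOn ℝ 2 η U)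
    (hinv : ∀ x ∈ U, (1 + jacS η x).det ≠ 0)
    (bbar : ℝ) (B : (Fin 3 → ℝ) → Fin 3 → ℝ)
    (hB : ∀ (x : Fin 3 → ℝ) (i : Fin 3),
      B x i = bbar * ((Pi.single (2 : Fin 3) (1 : ℝ) : Fin 3 → ℝ) i + jacS η x i 2)) :
    ∀ x ∈ U, ∀ i : Fin 3,
      (∑ j : Fin 3, ∑ k : Fin 3,
        B x j * ((1 + jacS η x)⁻¹)ᵀ j k *
          fderiv ℝ (fun y => B y i) x (Pi.single k 1))
      = bbar ^ 2 *
          fderiv ℝ (fun y => jacS η y i 2) x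
            (Pi.single (2 : Fin 3) (1 : ℝ)) := by
  intro x hx i
  have hdB : fderiv ℝ (fun y => B y i) x = bbar • fderiv ℝ (fun y => jacS η y i 2) x := by
    have h1 : (fun y => B y i) = bbar • (fun y =>
        (Pi.single (2 : Fin 3) (1 : ℝ) : Fin 3 → ℝ) i + jacS η y i 2) := by
      funext y
      simp [hB]
    rw [h1, fderiv_const_smul_field, Pi.smul_apply, fderiv_const_add]
  have hM : (1 + jacS η x)⁻¹ * (1 + jacS η x) = 1 :=
    Matrix.nonsing_inv_mul _ (isUnit_iff_ne_zero.mpr (hinv x hx))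
  have hBx : ∀ j, B x j = bbar * (1 + jacS η x) j 2 := by
    intro j
    rw [hB, Matrix.add_apply, Matrix.one_apply, Pi.single_apply]
  have hk : ∀ k, ∑ j, B x j * ((1 + jacS η x)⁻¹)ᵀ j k
      = bbar * (1 : Matrix (Fin 3) (Fin 3) ℝ) k 2 := by
    intro k
    have hM2 := congrFun (congrFun hM k) 2
    rw [← hM2, Matrix.mul_apply, Finset.mul_sum]
    refine Finset.sum_congr rfl fun j _ => ?_
    rw [hBx, Matrix.transpose_apply]
    ring
  rw [Finset.sum_comm]
  simp_rw [← Finset.sum_mul, hk, hdB]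
  simp [Matrix.one_apply]
  ring
end

section
/- Define Ψ : U → ℝ³ by Ψ₁ = η₁∂₂η₂ + η₁∂₃η₃ + η₁(∂₂η₂∂₃η₃ − ∂₃η₂∂₂η₃), Ψ₂ = −η₁∂₁η₂ + η₂∂₃η₃ + η₁(∂₃η₂∂₁η₃ − ∂₁η₂∂₃η₃), Ψ₃ = −η₁∂₁η₃ − η₂∂₂η₃ + η₁(∂₁η₂∂₂η₃ − ∂₂η₂∂₁η₃). Then for every x ∈ U, det(I + ∇η(x)) − 1 − div η(x) = div Ψ(x). In particular, the nonlinearity Φ := −(det(I + ∇η) − 1 − div η) is the divergence of the explicit C¹ vector field −Ψ, which vanishes at every point where η vanishes. -/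
open Matrix

/-- The partial derivative `∂_j η_i (x)` (0-based indices). -/
noncomputable def pD (η : (Fin 3 → ℝ) → Fin 3 → ℝ) (i j : Fin 3) (x : Fin 3 → ℝ) : ℝ :=
  fderiv ℝ (fun y => η y i) x (Pi.single j 1)

/-- The explicit vector field `Ψ` with
`Ψ₁ = η₁∂₂η₂ + η₁∂₃η₃ + η₁(∂₂η₂∂₃η₃ − ∂₃η₂∂₂η₃)`,
`Ψ₂ = −η₁∂₁η₂ + η₂∂₃η₃ + η₁(∂₃η₂∂₁η₃ − ∂₁η₂∂₃η₃)`,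
`Ψ₃ = −η₁∂₁η₃ − η₂∂₂η₃ + η₁(∂₁η₂∂₂η₃ − ∂₂η₂∂₁η₃)` (1-based notation). -/
noncomputable def Psi (η : (Fin 3 → ℝ) → Fin 3 → ℝ) (x : Fin 3 → ℝ) : Fin 3 → ℝ :=
  ![η x 0 * pD η 1 1 x + η x 0 * pD η 2 2 x +
      η x 0 * (pD η 1 1 x * pD η 2 2 x - pD η 1 2 x * pD η 2 1 x),
    -(η x 0) * pD η 1 0 x + η x 1 * pD η 2 2 x +
      η x 0 * (pD η 1 2 x * pD η 2 0 x - pD η 1 0 x * pD η 2 2 x),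
    -(η x 0) * pD η 2 0 x - η x 1 * pD η 2 1 x +
      η x 0 * (pD η 1 0 x * pD η 2 1 x - pD η 1 1 x * pD η 2 0 x)]

lemma comp_contDiffAt {U : Set (Fin 3 → ℝ)} (hU : IsOpen U)
    {η : (Fin 3 → ℝ) → Fin 3 → ℝ} (hη : ContDiffOn ℝ 2 η U) {x : Fin 3 → ℝ} (hx : x ∈ U)
    (i : Fin 3) : ContDiffAt ℝ 2 (fun y => η y i) x :=
  contDiffAt_pi.1 (hη.contDiffAt (hU.mem_nhds hx)) i

lemma pD_differentiableAt {η : (Fin 3 → ℝ) → Fin 3 → ℝ} {x : Fin 3 → ℝ} {i : Fin 3}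
    (h : ContDiffAt ℝ 2 (fun y => η y i) x) (j : Fin 3) :
    HasFDerivAt (pD η i j)
      ((fderiv ℝ (fderiv ℝ (fun y => η y i)) x).flip (Pi.single j 1)) x := by
  have h1 : DifferentiableAt ℝ (fderiv ℝ (fun y => η y i)) x :=
    (h.fderiv_right (m := 1) (by norm_num)).differentiableAt (by norm_num)
  have h2 := h1.hasFDerivAt.clm_apply (hasFDerivAt_const (Pi.single j (1:ℝ) : Fin 3 → ℝ) x)
  refine h2.congr_fderiv ?_
  ext v
  simp

lemma pD_symm {η : (Fin 3 → ℝ) → Fin 3 → ℝ} {x : Fin 3 → ℝ} {i : Fin 3}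
    (h : ContDiffAt ℝ 2 (fun y => η y i) x) (j k : Fin 3) :
    fderiv ℝ (pD η i j) x (Pi.single k 1) = fderiv ℝ (pD η i k) x (Pi.single j 1) := by
  rw [(pD_differentiableAt h j).fderiv, (pD_differentiableAt h k).fderiv]
  exact (h.isSymmSndFDerivAt (by simp)) _ _

lemma div_Psi {U : Set (Fin 3 → ℝ)} (hU : IsOpen U)
    {η : (Fin 3 → ℝ) → Fin 3 → ℝ} (hη : ContDiffOn ℝ 2 η U) {x : Fin 3 → ℝ} (hx : x ∈ U) :
    (1 + jacS η x).det - 1 - (∑ i : Fin 3, pD η i i x) =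
        ∑ j : Fin 3, fderiv ℝ (fun y => Psi η y j) x (Pi.single j 1) := by
  have hc := comp_contDiffAt hU hη hx
  have e : ∀ i, HasFDerivAt (fun y => η y i) (fderiv ℝ (fun y => η y i) x) x := fun i =>
    ((hc i).differentiableAt (by norm_num)).hasFDerivAt
  have p : ∀ i j, HasFDerivAt (fun y => pD η i j y) (fderiv ℝ (pD η i j) x) x := fun i j =>
    (pD_differentiableAt (hc i) j).differentiableAt.hasFDerivAt
  have q : ∀ i j, fderiv ℝ (fun y => η y i) x (Pi.single j 1) = pD η i j x := fun i j => rfl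
  have h0 : HasFDerivAt (fun y => Psi η y 0) _ x :=
    (((e 0).fun_mul (p 1 1)).fun_add ((e 0).fun_mul (p 2 2))).fun_add
      ((e 0).fun_mul (((p 1 1).fun_mul (p 2 2)).fun_sub ((p 1 2).fun_mul (p 2 1))))
  have h1 : HasFDerivAt (fun y => Psi η y 1) _ x :=
    (((e 0).fun_neg.fun_mul (p 1 0)).fun_add ((e 1).fun_mul (p 2 2))).fun_add
      ((e 0).fun_mul (((p 1 2).fun_mul (p 2 0)).fun_sub ((p 1 0).fun_mul (p 2 2))))
  have h2 : HasFDerivAt (fun y => Psi η y 2) _ x :=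
    (((e 0).fun_neg.fun_mul (p 2 0)).fun_sub ((e 1).fun_mul (p 2 1))).fun_add
      ((e 0).fun_mul (((p 1 0).fun_mul (p 2 1)).fun_sub ((p 1 1).fun_mul (p 2 0))))
  have J : ∀ i j, jacS η x i j = pD η i j x := fun i j => rfl
  rw [Fin.sum_univ_three, Fin.sum_univ_three, h0.fderiv, h1.fderiv, h2.fderiv, Matrix.det_fin_three]
  simp only [Matrix.add_apply, J, _root_.add_apply, _root_.sub_apply, _root_.neg_apply,
    _root_.smul_apply, smul_eq_mul, q]
  rw [pD_symm (hc 1) 1 0, pD_symm (hc 1) 2 0, pD_symm (hc 1) 2 1,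
    pD_symm (hc 2) 1 0, pD_symm (hc 2) 2 0, pD_symm (hc 2) 2 1]
  simp
  ring

/-- `det(I + ∇η) − 1 − div η = div Ψ` on `U`, and `Ψ` vanishes
wherever `η` vanishes; hence `Φ := −(det(I+∇η) − 1 − div η)` is the divergence
of the explicit vector field `−Ψ`. -/
theorem det_expansion_divergence_form (U : Set (Fin 3 → ℝ)) (hU : IsOpen U)
    (η : (Fin 3 → ℝ) → Fin 3 → ℝ) (hη : ContDiffOn ℝ 2 η U) :
    (∀ x ∈ U,
      (1 + jacS η x).det - 1 - (∑ i : Fin 3, pD η i i x) =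
        ∑ j : Fin 3, fderiv ℝ (fun y => Psi η y j) x (Pi.single j 1)) ∧
    (∀ x : Fin 3 → ℝ, η x = 0 → Psi η x = 0) ∧
    (∀ x ∈ U,
      -((1 + jacS η x).det - 1 - (∑ i : Fin 3, pD η i i x)) =
        ∑ j : Fin 3, fderiv ℝ (fun y => -(Psi η y j)) x (Pi.single j 1)) := by
  refine ⟨fun x hx => div_Psi hU hη hx, fun x hx => ?_, fun x hx => ?_⟩
  · ext j
    fin_cases j <;> simp [Psi, hx]
  · rw [div_Psi hU hη hx, ← Finset.sum_neg_distrib]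
    refine Finset.sum_congr rfl fun j _ => ?_
    rw [fderiv_fun_neg]
    rfl
end
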